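/- arXiv:1908.07486 — 3 statements merged into one kernel-verified Lean document; each statement's English description precedes it below -/
import Mathlib

section
/- Let 𝓗 be a complex Hilbert space, let D be a bounded self-adjoint operator on 𝓗 with ⟨x, D x⟩ ≥ ‖x‖² for every x ∈ 𝓗, let r be a real number with 0 ≤ r < 1/2, and let W be a bounded operator on 𝓗 such that |⟨x, W y⟩| ≤ r·√⟨x, D x⟩·√⟨y, D y⟩ for all x, y ∈ 𝓗. Then for every z ∈ ℂ with |z| ≤ 1/2 the operator D + W − z·1 is invertible (as a bounded operator, i.e. z is in the resolvent set of D + W), and ‖(D + W − z·1)⁻¹‖ ≤ 2/(1 − 2r). -/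
open scoped InnerProductSpace

/-- If `⟪x, A x⟫` has modulus at least `c ‖x‖²` for some `c > 0`, then `A` has a bounded inverse of
norm at most `c⁻¹`. -/
theorem exists_inverse_norm_le_of_forall_le_norm_inner_map
    {𝓗 : Type*} [NormedAddCommGroup 𝓗] [InnerProductSpace ℂ 𝓗] [CompleteSpace 𝓗]
    (A : 𝓗 →L[ℂ] 𝓗) {c : ℝ} (hc : 0 < c) (h : ∀ x : 𝓗, c * ‖x‖ ^ 2 ≤ ‖⟪x, A x⟫_ℂ‖) :
    ∃ T : 𝓗 →L[ℂ] 𝓗, A * T = 1 ∧ T * A = 1 ∧ ‖T‖ ≤ c⁻¹ := by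
  have hA : IsUnit A :=
    ContinuousLinearMap.isUnit_of_forall_le_norm_inner_map A (c := ⟨c, hc.le⟩) hc fun x => by
      rw [norm_inner_symm]
      calc ‖x‖ ^ 2 * c = c * ‖x‖ ^ 2 := mul_comm _ _
        _ ≤ _ := h x
  obtain ⟨u, rfl⟩ := hA
  refine ⟨↑u⁻¹, u.mul_inv, u.inv_mul, ?_⟩
  refine ContinuousLinearMap.opNorm_le_bound _ (by positivity) fun y => ?_
  set x : 𝓗 := (↑u⁻¹ : 𝓗 →L[ℂ] 𝓗) y with hx
  have hux : (u : 𝓗 →L[ℂ] 𝓗) x = y := by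
    rw [hx, ← mul_apply_eq_comp, u.mul_inv, one_apply_eq_self]
  have hle := (h x).trans (norm_inner_le_norm x _)
  rw [hux] at hle
  rw [inv_mul_eq_div, le_div_iff₀ hc]
  rcases (norm_nonneg x).eq_or_lt with h0 | h0
  · rw [← h0, zero_mul]
    exact norm_nonneg y
  · nlinarith

/-- **Resolvent estimate for a gapped operator with a small form-bounded perturbation.**
If `D` is a bounded self-adjoint operator with `⟪x, D x⟫ ≥ ‖x‖²`, `0 ≤ r < 1/2`, and `W` is a
bounded operator with `|⟪x, W y⟫| ≤ r √⟪x, D x⟫ √⟪y, D y⟫`, then for every `z` with `|z| ≤ 1/2`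
the operator `D + W - z·1` is boundedly invertible with `‖(D + W - z·1)⁻¹‖ ≤ 2/(1 - 2r)`. -/
theorem resolvent_bound_of_gap_and_form_bounded_perturbation
    {𝓗 : Type*} [NormedAddCommGroup 𝓗] [InnerProductSpace ℂ 𝓗] [CompleteSpace 𝓗]
    (D W : 𝓗 →L[ℂ] 𝓗) (hD : IsSelfAdjoint D)
    (hDgap : ∀ x : 𝓗, ‖x‖ ^ 2 ≤ (⟪x, D x⟫_ℂ).re)
    (r : ℝ) (hr0 : 0 ≤ r) (hr : r < 1 / 2)
    (hW : ∀ x y : 𝓗, ‖⟪x, W y⟫_ℂ‖ ≤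
      r * Real.sqrt (⟪x, D x⟫_ℂ).re * Real.sqrt (⟪y, D y⟫_ℂ).re)
    (z : ℂ) (hz : ‖z‖ ≤ 1 / 2) :
    ∃ T : 𝓗 →L[ℂ] 𝓗, (D + W - z • (1 : 𝓗 →L[ℂ] 𝓗)) * T = 1 ∧
      T * (D + W - z • (1 : 𝓗 →L[ℂ] 𝓗)) = 1 ∧ ‖T‖ ≤ 2 / (1 - 2 * r) := by
  have hc : 0 < 1 / 2 - r := by linarith
  have hcoer : ∀ x : 𝓗, (1 / 2 - r) * ‖x‖ ^ 2 ≤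
      ‖⟪x, (D + W - z • (1 : 𝓗 →L[ℂ] 𝓗)) x⟫_ℂ‖ := fun x => by
    have hgap := hDgap x
    have hd : 0 ≤ (⟪x, D x⟫_ℂ).re := (sq_nonneg _).trans hgap
    have hWx := hW x x
    rw [mul_assoc, Real.mul_self_sqrt hd] at hWx
    have hWre := (abs_le.mp ((Complex.abs_re_le_norm _).trans hWx)).1
    have hzx : ‖⟪x, z • x⟫_ℂ‖ ≤ 1 / 2 * ‖x‖ ^ 2 := by
      rw [inner_smul_right, norm_mul, inner_self_eq_norm_sq_to_K, norm_pow, RCLike.norm_ofReal,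
        abs_norm]
      gcongr
    have hzre := (Complex.re_le_norm _).trans hzx
    refine le_trans ?_ (Complex.re_le_norm _)
    simp only [sub_apply, add_apply,
      smul_apply, one_apply_eq_self, inner_sub_right,
      inner_add_right, Complex.sub_re, Complex.add_re]
    nlinarith
  obtain ⟨T, h₁, h₂, hT⟩ := exists_inverse_norm_le_of_forall_le_norm_inner_map _ hc hcoer
  refine ⟨T, h₁, h₂, hT.trans_eq ?_⟩
  rw [show 1 - 2 * r = 2 * (1 / 2 - r) by ring]
  field_simp
end

section
/- Let 𝓗 be a complex Hilbert space, let D be a bounded self-adjoint operator on 𝓗 with ⟨x, D x⟩ ≥ ‖x‖² for every x ∈ 𝓗, let r be a real number with 0 ≤ r < 1/2, and let W be a bounded operator on 𝓗 such that |⟨x, W y⟩| ≤ r·√⟨x, D x⟩·√⟨y, D y⟩ for all x, y ∈ 𝓗. Then for every z ∈ ℂ with |z| ≤ 1/2 the operator D + W − z·1 is invertible and ‖(D + W − z·1)⁻¹ ∘ √D‖ ≤ 2/(1 − 2r), where √D denotes the positive square root of the positive operator D given by the continuous functional calculus. -/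
set_option synthInstance.maxHeartbeats 1000000

open scoped InnerProductSpace

/-- The form of `D + W - z` is bounded below by `(1/2 - r)` times the form of `D`. -/
lemma re_inner_add_sub_smul_one_ge
    {𝓗 : Type*} [NormedAddCommGroup 𝓗] [InnerProductSpace ℂ 𝓗] (D W : 𝓗 →L[ℂ] 𝓗) (r : ℝ) (z : ℂ)
    (hz : ‖z‖ ≤ 1 / 2) (x : 𝓗) (hDgap : ‖x‖ ^ 2 ≤ (⟪x, D x⟫_ℂ).re)
    (hW : ‖⟪x, W x⟫_ℂ‖ ≤ r * Real.sqrt (⟪x, D x⟫_ℂ).re * Real.sqrt (⟪x, D x⟫_ℂ).re) :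
    (1 / 2 - r) * (⟪x, D x⟫_ℂ).re ≤ (⟪x, (D + W - z • (1 : 𝓗 →L[ℂ] 𝓗)) x⟫_ℂ).re := by
  have hd : 0 ≤ (⟪x, D x⟫_ℂ).re := (sq_nonneg _).trans hDgap
  rw [mul_assoc, Real.mul_self_sqrt hd] at hW
  have hWre : -‖⟪x, W x⟫_ℂ‖ ≤ (⟪x, W x⟫_ℂ).re :=
    neg_le_of_abs_le (Complex.abs_re_le_norm _)
  have hzre : (z * ⟪x, x⟫_ℂ).re ≤ 1 / 2 * ‖x‖ ^ 2 :=
    calc (z * ⟪x, x⟫_ℂ).re ≤ ‖z * ⟪x, x⟫_ℂ‖ := Complex.re_le_norm _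
      _ ≤ ‖z‖ * (‖x‖ * ‖x‖) := by rw [norm_mul]; gcongr; exact norm_inner_le_norm x x
      _ ≤ 1 / 2 * ‖x‖ ^ 2 := by rw [← sq]; gcongr
  have hsplit : (⟪x, (D + W - z • (1 : 𝓗 →L[ℂ] 𝓗)) x⟫_ℂ).re
      = (⟪x, D x⟫_ℂ).re + (⟪x, W x⟫_ℂ).re - (z * ⟪x, x⟫_ℂ).re := by
    simp
  linarith

/-- **Weighted resolvent estimate (Lemma A.1, abstract form).**
If `D` is a bounded self-adjoint operator with `⟪x, D x⟫ ≥ ‖x‖²`, `0 ≤ r < 1/2`, and `W` is a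
bounded operator with `|⟪x, W y⟫| ≤ r √⟪x, D x⟫ √⟪y, D y⟫`, then for every `z` with `|z| ≤ 1/2`
the operator `D + W - z·1` is boundedly invertible and
`‖(D + W - z·1)⁻¹ ∘ √D‖ ≤ 2/(1 - 2r)`, where `√D = CFC.sqrt D` is the positive square root of
`D` given by the continuous functional calculus. -/
theorem weighted_resolvent_bound_of_gap_and_form_bounded_perturbation
    {𝓗 : Type*} [NormedAddCommGroup 𝓗] [InnerProductSpace ℂ 𝓗] [CompleteSpace 𝓗]
    (D W : 𝓗 →L[ℂ] 𝓗) (hD : IsSelfAdjoint D)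
    (hDgap : ∀ x : 𝓗, ‖x‖ ^ 2 ≤ (⟪x, D x⟫_ℂ).re)
    (r : ℝ) (hr0 : 0 ≤ r) (hr : r < 1 / 2)
    (hW : ∀ x y : 𝓗, ‖⟪x, W y⟫_ℂ‖ ≤
      r * Real.sqrt (⟪x, D x⟫_ℂ).re * Real.sqrt (⟪y, D y⟫_ℂ).re)
    (z : ℂ) (hz : ‖z‖ ≤ 1 / 2) :
    ∃ T : 𝓗 →L[ℂ] 𝓗, (D + W - z • (1 : 𝓗 →L[ℂ] 𝓗)) * T = 1 ∧
      T * (D + W - z • (1 : 𝓗 →L[ℂ] 𝓗)) = 1 ∧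
      ‖T * CFC.sqrt D‖ ≤ 2 / (1 - 2 * r) := by
  set A : 𝓗 →L[ℂ] 𝓗 := D + W - z • (1 : 𝓗 →L[ℂ] 𝓗) with hA
  have hc : 0 < 1 / 2 - r := by linarith
  have hAD (x : 𝓗) : (1 / 2 - r) * (⟪x, D x⟫_ℂ).re ≤ (⟪x, A x⟫_ℂ).re :=
    re_inner_add_sub_smul_one_ge D W r z hz x (hDgap x) (hW x x)
  have hunit : IsUnit A := by
    refine A.isUnit_of_forall_le_norm_inner_map (c := ⟨1 / 2 - r, hc.le⟩) hc fun x ↦ ?_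
    calc ‖x‖ ^ 2 * (1 / 2 - r) ≤ (1 / 2 - r) * (⟪x, D x⟫_ℂ).re := by
          rw [mul_comm]; gcongr; exact hDgap x
      _ ≤ (⟪x, A x⟫_ℂ).re := hAD x
      _ ≤ ‖⟪x, A x⟫_ℂ‖ := Complex.re_le_norm _
      _ = ‖⟪A x, x⟫_ℂ‖ := norm_inner_symm _ _
  obtain ⟨T, hAT, hTA⟩ := isUnit_iff_exists.mp hunit
  refine ⟨T, hAT, hTA, ?_⟩
  have hD0 : 0 ≤ D := by
    rw [ContinuousLinearMap.nonneg_iff_isPositive, ContinuousLinearMap.isPositive_def']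
    refine ⟨hD, fun x ↦ ?_⟩
    rw [ContinuousLinearMap.reApplyInnerSelf_apply, inner_re_symm]
    exact (sq_nonneg _).trans (hDgap x)
  set S := CFC.sqrt D with hS
  have hSsymm (x y : 𝓗) : ⟪x, S y⟫_ℂ = ⟪S x, y⟫_ℂ :=
    (((ContinuousLinearMap.nonneg_iff_isPositive S).mp
      (CFC.sqrt_nonneg D)).inner_left_eq_inner_right x y).symm
  have hDS (x : 𝓗) : (⟪x, D x⟫_ℂ).re = ‖S x‖ ^ 2 := by
    have hDx : D x = S (S x) := by
      rw [← mul_apply_eq_comp, hS, CFC.sqrt_mul_sqrt_self D hD0]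
    rw [hDx, hSsymm]
    exact inner_self_eq_norm_sq (𝕜 := ℂ) (S x)
  have hr2 : 0 < 1 - 2 * r := by linarith
  refine ContinuousLinearMap.opNorm_le_bound _ (by positivity) fun y ↦ ?_
  set u := (T * S) y with hu
  have hAu : A u = S y := by
    rw [hu, ← mul_apply_eq_comp, ← mul_assoc, hAT, one_mul]
  have hquad : (1 / 2 - r) * ‖S u‖ ^ 2 ≤ ‖S u‖ * ‖y‖ := by
    rw [← hDS]
    calc (1 / 2 - r) * (⟪u, D u⟫_ℂ).re ≤ (⟪u, A u⟫_ℂ).re := hAD u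
      _ = (⟪S u, y⟫_ℂ).re := by rw [hAu, hSsymm]
      _ ≤ ‖⟪S u, y⟫_ℂ‖ := Complex.re_le_norm _
      _ ≤ ‖S u‖ * ‖y‖ := norm_inner_le_norm _ _
  have huS : ‖u‖ ≤ ‖S u‖ :=
    le_of_sq_le_sq (by rw [← hDS]; exact hDgap u) (norm_nonneg _)
  have hSu : (1 / 2 - r) * ‖S u‖ ≤ ‖y‖ := by
    rcases (norm_nonneg (S u)).eq_or_lt with h | h
    · rw [← h, mul_zero]; exact norm_nonneg y
    · exact le_of_mul_le_mul_left (by linarith) h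
  rw [div_mul_eq_mul_div, le_div_iff₀ hr2]
  nlinarith
end

section
/- Let a > 0 and v > 0 be real numbers, and define B : {1,2,…} → ℝ recursively by B 1 = v and B j = (1/a)·∑_{k=1}^{j−1} B (j−k) · B k for j ≥ 2. Then for every real x with 0 ≤ x ≤ a/(4v): the series ∑_{j=1}^∞ B j · x^j is summable, its sum equals (a/2)·(1 − √(1 − 4vx/a)), and this sum satisfies ∑_{j=1}^∞ B j · x^j ≤ v·x·(1 + 4vx/a) ≤ 2·v·x. -/
open Finset in
theorem sum_range_sum_antidiagonal_mul_le_sq {b : ℕ → ℝ} (hb : ∀ n, 0 ≤ b n) (n : ℕ) :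
    ∑ i ∈ range n, ∑ p ∈ HasAntidiagonal.antidiagonal i, b p.1 * b p.2 ≤
      (∑ i ∈ range n, b i) ^ 2 := by
  rw [sq, sum_mul_sum, ← sum_product', ← sum_biUnion]
  · refine sum_le_sum_of_subset_of_nonneg ?_ fun p _ _ => mul_nonneg (hb _) (hb _)
    intro p hp
    simp only [mem_biUnion, mem_range, HasAntidiagonal.mem_antidiagonal, mem_product] at hp ⊢
    omega
  · intro i _ j _ hij
    refine disjoint_left.2 fun p hi hj => hij ?_
    rw [← HasAntidiagonal.mem_antidiagonal.1 hi, ← HasAntidiagonal.mem_antidiagonal.1 hj]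

/-- A nonnegative sequence obeying the scaled Catalan recursion sums to any root `r ≤ a / 2` of
`r = b 0 + r ^ 2 / a`. -/
theorem hasSum_of_antidiagonal_recursion {a r : ℝ} (ha : 0 < a) {b : ℕ → ℝ}
    (hb : ∀ n, 0 ≤ b n)
    (hrec : ∀ n, b (n + 1) = 1 / a * ∑ p ∈ Finset.HasAntidiagonal.antidiagonal n, b p.1 * b p.2)
    (hr0 : 0 ≤ r) (hr : r ≤ a / 2) (hroot : r = b 0 + 1 / a * r ^ 2) : HasSum b r := by
  have hle : ∀ n, ∑ i ∈ Finset.range n, b i ≤ r := by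
    intro n
    induction n with
    | zero => simpa using hr0
    | succ n ih =>
      rw [Finset.sum_range_succ', hroot, add_comm]
      simp only [hrec, ← Finset.mul_sum]
      have h0 : 0 ≤ ∑ i ∈ Finset.range n, b i := Finset.sum_nonneg fun i _ => hb i
      have h1 := sum_range_sum_antidiagonal_mul_le_sq hb n
      gcongr
      exact h1.trans (by gcongr)
  have hs : Summable b := summable_of_sum_range_le hb hle
  have hF : ∑' n, b n ≤ r := hs.tsum_le_of_sum_range_le hle
  have hroot' : ∑' n, b n = b 0 + 1 / a * (∑' n, b n) ^ 2 := by
    have hn : Summable fun n => ‖b n‖ := hs.norm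
    rw [sq, tsum_mul_tsum_eq_tsum_sum_antidiagonal_of_summable_norm hn hn, ← tsum_mul_left,
      hs.tsum_eq_zero_add]
    simp only [hrec]
  have hprod : (r - ∑' n, b n) * (a - r - ∑' n, b n) = 0 := by
    field_simp at hroot hroot'
    linarith
  have heq : ∑' n, b n = r := by
    rcases mul_eq_zero.1 hprod with h | h <;> linarith
  exact heq ▸ hs.hasSum

/-- **Generating function and 2v-bound for the Lie–Schwinger majorant sequence (Lemma A.2).**
With `B 1 = v` and `B j = (1/a) ∑_{k=1}^{j-1} B (j-k) B k` for `j ≥ 2`, for every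
`0 ≤ x ≤ a/(4v)` the series `∑_{j≥1} B j x^j` is summable with sum
`(a/2)(1 - √(1 - 4vx/a))`, and this sum is at most `v x (1 + 4vx/a) ≤ 2 v x`. -/
theorem majorant_series_sum_and_bound (a v : ℝ) (ha : 0 < a) (hv : 0 < v)
    (B : ℕ → ℝ) (hB1 : B 1 = v)
    (hBrec : ∀ j, 2 ≤ j → B j = (1 / a) * ∑ k ∈ Finset.Ico 1 j, B (j - k) * B k)
    (x : ℝ) (hx0 : 0 ≤ x) (hx : x ≤ a / (4 * v)) :
    Summable (fun j : ℕ => B (j + 1) * x ^ (j + 1)) ∧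
      (∑' j : ℕ, B (j + 1) * x ^ (j + 1))
        = (a / 2) * (1 - Real.sqrt (1 - 4 * v * x / a)) ∧
      (∑' j : ℕ, B (j + 1) * x ^ (j + 1)) ≤ v * x * (1 + 4 * v * x / a) ∧
      v * x * (1 + 4 * v * x / a) ≤ 2 * v * x := by
  have hxv : 4 * v * x ≤ a := by
    rw [le_div_iff₀ (by positivity)] at hx
    linarith
  have ht1 : 4 * v * x / a ≤ 1 := (div_le_one ha).2 hxv
  have ht0 : 0 ≤ 4 * v * x / a := by positivity
  have hvx : v * x = a / 4 * (4 * v * x / a) := by field_simp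
  have hs0 := Real.sqrt_nonneg (1 - 4 * v * x / a)
  have hsq := Real.sq_sqrt (sub_nonneg.2 ht1)
  have hs1 : √(1 - 4 * v * x / a) ≤ 1 := Real.sqrt_le_one.2 (by linarith)
  have hBnonneg : ∀ j, 1 ≤ j → 0 ≤ B j := by
    intro j
    induction j using Nat.strong_induction_on with
    | _ j ih =>
      intro hj
      rcases hj.eq_or_lt with rfl | hj
      · exact hB1 ▸ hv.le
      · rw [hBrec j hj]
        refine mul_nonneg (by positivity) (Finset.sum_nonneg fun k hk => ?_)
        rw [Finset.mem_Ico] at hk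
        exact mul_nonneg (ih _ (by omega) (by omega)) (ih _ hk.2 hk.1)
  have hrec : ∀ n, B (n + 1 + 1) * x ^ (n + 1 + 1) = 1 / a *
      ∑ p ∈ Finset.HasAntidiagonal.antidiagonal n,
        B (p.1 + 1) * x ^ (p.1 + 1) * (B (p.2 + 1) * x ^ (p.2 + 1)) := by
    intro n
    rw [hBrec _ (by omega), Finset.sum_Ico_eq_sum_range, mul_assoc, Finset.sum_mul,
      ← Finset.Nat.sum_antidiagonal_swap, Finset.Nat.sum_antidiagonal_eq_sum_range_succ_mk]
    congr 1
    refine Finset.sum_congr rfl fun k hk => ?_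
    obtain ⟨m, rfl⟩ := Nat.exists_eq_add_of_le (Finset.mem_range_succ_iff.1 hk)
    have h1 : k + m + 1 + 1 - (k + 1) = m + 1 := by omega
    have h2 : k + m - k = m := by omega
    simp only [h1, h2, Prod.swap, add_comm 1 k]
    ring
  set s := √(1 - 4 * v * x / a)
  set t := 4 * v * x / a
  have hsum : HasSum (fun j : ℕ => B (j + 1) * x ^ (j + 1)) (a / 2 * (1 - s)) := by
    refine hasSum_of_antidiagonal_recursion ha
      (fun n => mul_nonneg (hBnonneg _ (by omega)) (by positivity)) hrec
      (mul_nonneg (by positivity) (by linarith)) (by nlinarith) ?_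
    have h : 1 / a * (a / 2 * (1 - s)) ^ 2 = a / 4 * (1 - s) ^ 2 := by
      field_simp
      ring
    rw [h, zero_add, pow_one, hB1, hvx]
    linear_combination -a / 4 * hsq
  refine ⟨hsum.summable, hsum.tsum_eq, ?_, ?_⟩
  · rw [hsum.tsum_eq, hvx]
    have ht : t = 1 - s ^ 2 := by linarith
    have hpoly : 2 * (1 - s) ≤ t * (1 + t) := by
      have : 0 ≤ s * (1 - s) * (1 - s) * (2 + s) := by
        have := sub_nonneg.2 hs1
        positivity
      rw [ht]
      linarith
    nlinarith
  · have : 0 ≤ v * x := by positivity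
    nlinarith
end
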